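/- For every prime power q ≥ 5 and every integer d satisfying 3q⁴ − 5q³ + q² + q ≤ d ≤ 3q⁴ − 5q³ + 2q², there exists an [g_q(5,d), 5, d]_q linear code. -/

import Mathlib

/-- `C` is an `[n, k, d]_q` linear code over `F`: a `k`-dimensional `F`-linear subspace of
`F^n` such that the minimum Hamming weight of a nonzero codeword equals `d`. -/
def IsLinearCodeWith (F : Type) [Field F] [DecidableEq F] (n k d : ℕ)
    (C : Submodule F (Fin n → F)) : Prop :=
  Module.finrank F C = k ∧
  (∀ c ∈ C, c ≠ 0 → d ≤ hammingNorm c) ∧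
  (∃ c ∈ C, c ≠ 0 ∧ hammingNorm c = d)

/-- The Griesmer function `g_q(k, d) = ∑_{i=0}^{k-1} ⌈d / q^i⌉`. -/
def griesmer (q k d : ℕ) : ℕ := ∑ i ∈ Finset.range k, (d + q ^ i - 1) / q ^ i

set_option linter.all false

/-- exact minimum distance -/
lemma exact_code {F : Type} [Field F] [DecidableEq F] {W : Type} [AddCommGroup W] [Module F W]
    (n k d : ℕ) (hd : 1 ≤ d) (hk : 1 ≤ k) (hW : Module.finrank F W = k)
    (f : W →ₗ[F] (Fin n → F)) (hf : ∀ w, w ≠ 0 → d ≤ hammingNorm (f w)) :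
    ∃ C : Submodule F (Fin n → F), IsLinearCodeWith F n k d C := by
  classical
  let Z : ℕ → (Fin n → F) →ₗ[F] (Fin n → F) := fun j =>
    { toFun := fun c i => if (i : ℕ) < j then 0 else c i
      map_add' := by intro x y; ext i; by_cases h : (i : ℕ) < j <;> simp [h]
      map_smul' := by intro x y; ext i; by_cases h : (i : ℕ) < j <;> simp [h] }
  have hZ : ∀ j c i, Z j c i = if (i : ℕ) < j then 0 else c i := fun j c i => rfl
  have : Nontrivial W := Module.nontrivial_of_finrank_pos (R := F) (by omega)
  obtain ⟨w0, hw0⟩ := exists_ne (0 : W)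
  have hex : ∃ j, ¬ (∀ w, w ≠ 0 → d ≤ hammingNorm (Z j (f w))) := by
    refine ⟨n, fun h => ?_⟩
    have h1 := h w0 hw0
    have : Z n (f w0) = 0 := by ext i; simp [hZ]
    rw [this, hammingNorm_zero] at h1
    omega
  have hspec := Nat.find_spec hex
  have hmin := fun m => Nat.find_min hex (m := m)
  set J := Nat.find hex
  have hJ : J ≠ 0 := by
    intro h0
    apply hspec
    rw [h0]
    intro w hw
    have : Z 0 (f w) = f w := by ext i; simp [hZ]
    rw [this]; exact hf w hw
  obtain ⟨j, hj⟩ := Nat.exists_eq_succ_of_ne_zero hJ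
  have hP := hmin j (by omega)
  push Not at hP hspec
  obtain ⟨w, hw, hlt⟩ := hspec
  rw [hj] at hlt
  have hle : hammingNorm (Z j (f w)) ≤ hammingNorm (Z (j+1) (f w)) + 1 := by
    by_cases hjn : j < n
    · unfold hammingNorm
      refine (Finset.card_le_card (t := insert ⟨j, hjn⟩ _) ?_).trans (Finset.card_insert_le _ _)
      intro i hi
      simp only [Finset.mem_filter, Finset.mem_univ, true_and, Finset.mem_insert, hZ, Fin.ext_iff] at hi ⊢
      by_cases h : (i : ℕ) = j
      · exact Or.inl h
      · right
        by_cases h2 : (i : ℕ) < j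
        · simp [h2] at hi
        · simpa [h2, show ¬ (i : ℕ) < j + 1 by omega] using hi
    · have : Z j (f w) = Z (j+1) (f w) := by
        ext i
        simp [hZ, show (i : ℕ) < j by omega, show (i : ℕ) < j + 1 by omega]
      rw [this]; omega
  have hinj : Function.Injective (Z j ∘ₗ f) := by
    rw [← LinearMap.ker_eq_bot, LinearMap.ker_eq_bot']
    intro m hm
    by_contra hne
    have := hP m hne
    simp only [LinearMap.comp_apply] at hm
    rw [hm, hammingNorm_zero] at this
    omega
  refine ⟨LinearMap.range (Z j ∘ₗ f), ?_, ?_, ?_⟩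
  · rw [LinearMap.finrank_range_of_inj hinj, hW]
  · rintro c ⟨m, rfl⟩ hc
    apply hP
    rintro rfl
    simp at hc
  · refine ⟨_, ⟨w, rfl⟩, ?_, ?_⟩
    · intro h
      exact hw (hinj (by rw [h, map_zero]))
    · have := hP w hw
      simp only [LinearMap.comp_apply]
      simp only [Nat.succ_eq_add_one] at hlt
      omega

lemma sum_nonzero {F V : Type} [Field F] [Fintype F] [AddCommGroup V] [Module F V] [Fintype V]
    [DecidableEq V] [Fintype (Projectivization F V)] (g : V → ℕ) (hg : ∀ (c : F) v, c ≠ 0 → g (c • v) = g v) :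
    ∑ v ∈ Finset.univ.filter (fun v : V => v ≠ 0), g v
      = (Fintype.card F - 1) * ∑ p : Projectivization F V, g p.rep := by
  classical
  rw [← Finset.sum_subtype_eq_sum_filter]
  have h1 : ∑ x ∈ Finset.subtype (fun v : V => v ≠ 0) Finset.univ, g x
     = ∑ x : {v : V // v ≠ 0}, g x := by
    apply Finset.sum_congr _ (fun _ _ => rfl)
    ext; simp
  rw [h1]
  have h2 : ∀ x : {v : V // v ≠ 0}, g x = g (Projectivization.mk F x.1 x.2).rep := by
    intro x
    obtain ⟨a, ha⟩ := Projectivization.exists_smul_eq_mk_rep F x.1 x.2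
    rw [← ha, Units.smul_def, hg _ _ a.ne_zero]
  have h3 := Fintype.sum_equiv (Projectivization.nonZeroEquivProjectivizationProdUnits F V)
    (fun x => g (Projectivization.mk F x.1 x.2).rep) (fun y => g y.1.rep) (by intro x; rfl)
  rw [Finset.sum_congr rfl (fun x _ => h2 x), h3, Fintype.sum_prod_type]
  simp [Finset.mul_sum, Fintype.card_units]

lemma code_of_weights {F : Type} [Field F] [Fintype F] [DecidableEq F] {V : Type}
    [AddCommGroup V] [Module F V] [Fintype V] [DecidableEq V] (n k d : ℕ) (hd : 1 ≤ d) (hk : 1 ≤ k)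
    (hV : Module.finrank F V = k) (K : V → ℕ) (hK : ∀ (c : F) v, c ≠ 0 → K (c • v) = K v)
    (hn : ∑ v ∈ Finset.univ.filter (fun v : V => v ≠ 0), K v = (Fintype.card F - 1) * n)
    (hw : ∀ φ : V →ₗ[F] F, φ ≠ 0 → (Fintype.card F - 1) * d ≤
      ∑ v ∈ Finset.univ.filter (fun v : V => φ v ≠ 0), K v) :
    ∃ C : Submodule F (Fin n → F), IsLinearCodeWith F n k d C := by
  classical
  have : Finite (Projectivization F V) := Quotient.finite _
  let _ : Fintype (Projectivization F V) := Fintype.ofFinite _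
  have hq : 0 < Fintype.card F - 1 := by
    have := Fintype.one_lt_card (α := F); omega
  have hcard : Fintype.card (Σ p : Projectivization F V, Fin (K p.rep)) = n := by
    simp only [Fintype.card_sigma, Fintype.card_fin]
    rw [sum_nonzero K hK] at hn
    exact Nat.eq_of_mul_eq_mul_left hq hn
  let e := Fintype.equivFinOfCardEq hcard
  let f : (V →ₗ[F] F) →ₗ[F] (Fin n → F) :=
    { toFun := fun φ i => φ (e.symm i).1.rep
      map_add' := by intro x y; ext; simp
      map_smul' := by intro x y; ext; simp }
  refine exact_code n k d hd hk (W := V →ₗ[F] F) ?_ f ?_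
  · rw [← hV]; exact Subspace.dual_finrank_eq
  · intro φ hφ
    have h1 := hw φ hφ
    have h2 := sum_nonzero (fun v => if φ v ≠ 0 then K v else 0) (by
      intro (c : F) v hc
      simp only [map_smul, smul_eq_mul, ne_eq, mul_eq_zero, hc, false_or, hK c v hc])
    have h3 : ∑ v ∈ Finset.univ.filter (fun v : V => v ≠ 0), (if φ v ≠ 0 then K v else 0)
       = ∑ v ∈ Finset.univ.filter (fun v : V => φ v ≠ 0), K v := by
      rw [← Finset.sum_filter, Finset.filter_filter]
      apply Finset.sum_congr _ (fun _ _ => rfl)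
      ext v
      simp only [Finset.mem_filter, Finset.mem_univ, true_and, and_iff_right_iff_imp]
      rintro h rfl
      simp at h
    rw [h3] at h2
    have h4 : hammingNorm (f φ) = ∑ p : Projectivization F V, if φ p.rep ≠ 0 then K p.rep else 0 := by
      unfold hammingNorm
      rw [Finset.card_filter, Fintype.sum_equiv e.symm (g := fun x => if φ x.1.rep ≠ 0 then 1 else 0)]
      · rw [Fintype.sum_sigma]
        apply Finset.sum_congr rfl
        intro p _
        by_cases h : φ p.rep = 0 <;> simp [h]
      · intro i; rfl
    rw [h4]
    rw [h2] at h1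
    exact Nat.le_of_mul_le_mul_left h1 hq

/-- integer indicator -/
noncomputable def chi {F V : Type} [Field F] [AddCommGroup V] [Module F V] (W : Submodule F V) (v : V) : ℤ :=
  open Classical in if v ∈ W then 1 else 0

/-- not contained in the kernel -/
noncomputable def Iw {F V : Type} [Field F] [AddCommGroup V] [Module F V] (φ : V →ₗ[F] F) (W : Submodule F V) : ℤ :=
  open Classical in if W ≤ LinearMap.ker φ then 0 else 1

lemma chi_smul {F V : Type} [Field F] [AddCommGroup V] [Module F V] (W : Submodule F V) (c : F) (v : V)
    (hc : c ≠ 0) : chi W (c • v) = chi W v := by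
  have h : c • v ∈ W ↔ v ∈ W := Submodule.smul_mem_iff _ hc
  unfold chi
  by_cases h2 : v ∈ W
  · rw [if_pos h2, if_pos (h.2 h2)]
  · rw [if_neg h2, if_neg (fun h3 => h2 (h.1 h3))]

lemma sum_chi {F V : Type} [Field F] [Fintype F] [AddCommGroup V] [Module F V] [Fintype V]
    (W : Submodule F V) : ∑ v, chi W v = (Fintype.card F : ℤ) ^ Module.finrank F W := by
  classical
  unfold chi
  rw [Finset.sum_boole]
  rw [← Nat.cast_pow, ← Module.card_eq_pow_finrank (K := F) (V := W), Fintype.card_subtype]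

lemma sum_chi_nonzero {F V : Type} [Field F] [Fintype F] [AddCommGroup V] [Module F V] [Fintype V]
    [DecidableEq V] (W : Submodule F V) : ∑ v ∈ Finset.univ.filter (fun v : V => v ≠ 0), chi W v
      = (Fintype.card F : ℤ) ^ Module.finrank F W - 1 := by
  classical
  have h := Finset.sum_filter_add_sum_filter_not Finset.univ (fun v : V => v ≠ 0) (chi W)
  rw [sum_chi] at h
  have : ∑ v ∈ Finset.univ.filter (fun v : V => ¬ v ≠ 0), chi W v = 1 := by
    have h0 : Finset.univ.filter (fun v : V => ¬ v ≠ 0) = {0} := by ext; simp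
    rw [h0, Finset.sum_singleton]
    simp [chi]
  linarith

lemma sum_chi_phi {F V : Type} [Field F] [Fintype F] [DecidableEq F] [AddCommGroup V] [Module F V] [Fintype V]
    (W : Submodule F V) (φ : V →ₗ[F] F) (m : ℕ) (hm : Module.finrank F W = m + 1) :
    ∑ v ∈ Finset.univ.filter (fun v : V => φ v ≠ 0), chi W v
      = ((Fintype.card F : ℤ) - 1) * ((Fintype.card F : ℤ) ^ m * Iw φ W) := by
  classical
  unfold Iw
  split_ifs with hW
  · rw [mul_zero, mul_zero]
    apply Finset.sum_eq_zero
    intro v hv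
    simp only [Finset.mem_filter, Finset.mem_univ, true_and] at hv
    unfold chi
    rw [if_neg]
    intro h; exact hv (hW h)
  · have h := Finset.sum_filter_add_sum_filter_not Finset.univ (fun v : V => φ v ≠ 0) (chi W)
    rw [sum_chi, hm] at h
    have h2 : ∑ v ∈ Finset.univ.filter (fun v : V => ¬ φ v ≠ 0), chi W v
        = ∑ v, chi (W ⊓ LinearMap.ker φ) v := by
      rw [Finset.sum_filter]
      apply Finset.sum_congr rfl
      intro v _
      by_cases h : φ v = 0 <;> simp [chi, h]
    have h3 : Module.finrank F (W ⊓ LinearMap.ker φ : Submodule F V) = m := by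
      have h5 := LinearMap.finrank_range_add_finrank_ker (φ.domRestrict W)
      have h6 : LinearMap.range (φ.domRestrict W) = ⊤ := by
        rw [LinearMap.range_eq_top]
        apply LinearMap.surjective
        intro h0
        apply hW
        intro v hv
        have := LinearMap.congr_fun h0 ⟨v, hv⟩
        simpa using this
      rw [h6, finrank_top, Module.finrank_self, hm] at h5
      have h7 : (W ⊓ LinearMap.ker φ : Submodule F V) = (LinearMap.ker (φ.domRestrict W)).map W.subtype := by
        ext v
        simp [LinearMap.mem_ker]
        tauto
      rw [h7, Submodule.finrank_map_subtype_eq]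
      omega
    rw [h2, sum_chi, h3] at h
    rw [pow_succ] at h
    linear_combination h

/-- the ambient space -/
abbrev V5 (F : Type) : Type := F × F × F × F × F

/-- planes -/
def mG {F : Type} [Field F] (t : F) : (F × F × F) →ₗ[F] V5 F where
  toFun x := (-t * x.1, x.1, -t * x.2.1 - t ^ 2 * x.2.2, x.2.1, x.2.2)
  map_add' x y := by ext <;> simp <;> ring
  map_smul' c x := by ext <;> simp <;> ring

/-- the axis plane -/
def mL {F : Type} [Field F] : (F × F × F) →ₗ[F] V5 F where
  toFun x := (0, 0, x.1, x.2.1, x.2.2)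
  map_add' x y := by ext <;> simp <;> ring
  map_smul' c x := by ext <;> simp <;> ring

/-- hyperplane 1 -/
def mA {F : Type} [Field F] : (F × F × F × F) →ₗ[F] V5 F where
  toFun x := (0, x.1, x.2.1, x.2.2.1, x.2.2.2)
  map_add' x y := by ext <;> simp <;> ring
  map_smul' c x := by ext <;> simp <;> ring

/-- hyperplane 2 -/
def mB {F : Type} [Field F] : (F × F × F × F) →ₗ[F] V5 F where
  toFun x := (x.1, 0, x.2.1, x.2.2.1, x.2.2.2)
  map_add' x y := by ext <;> simp <;> ring
  map_smul' c x := by ext <;> simp <;> ring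

/-- hyperplane 3 -/
def mU {F : Type} [Field F] : (F × F × F × F) →ₗ[F] V5 F where
  toFun x := (x.1, x.2.1, 0, x.2.2.1, x.2.2.2)
  map_add' x y := by ext <;> simp <;> ring
  map_smul' c x := by ext <;> simp <;> ring

/-- hyperplane 5 -/
def mW {F : Type} [Field F] : (F × F × F × F) →ₗ[F] V5 F where
  toFun x := (x.1, x.2.1, x.2.2.1, x.2.2.2, 0)
  map_add' x y := by ext <;> simp <;> ring
  map_smul' c x := by ext <;> simp <;> ring

/-- removed lines -/
def mS {F : Type} [Field F] (s : F) : (F × F) →ₗ[F] V5 F where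
  toFun x := (x.1, x.2, s * x.1, 0, s * x.2)
  map_add' x y := by ext <;> simp <;> ring
  map_smul' c x := by ext <;> simp <;> ring

/-- removed points -/
def mY {F : Type} [Field F] (y : F) : F →ₗ[F] V5 F where
  toFun x := (x, x, 0, x, y * x)
  map_add' x y := by ext <;> simp <;> ring
  map_smul' c x := by ext <;> simp <;> ring

section
variable {F : Type} [Field F]
open LinearMap (range)

lemma mem_G (t a b u v w : F) : (a, b, u, v, w) ∈ range (mG t) ↔ a + t * b = 0 ∧ u + t * v + t ^ 2 * w = 0 := by
  simp only [LinearMap.mem_range, mG, LinearMap.coe_mk, AddHom.coe_mk, Prod.mk.injEq, Prod.exists]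
  constructor
  · rintro ⟨_, _, _, rfl, rfl, rfl, rfl, rfl⟩
    constructor <;> ring
  · rintro ⟨h1, h2⟩
    exact ⟨b, v, w, by linear_combination -h1, rfl, by linear_combination -h2, rfl, rfl⟩

lemma mem_L (a b u v w : F) : (a, b, u, v, w) ∈ range (mL (F := F)) ↔ a = 0 ∧ b = 0 := by
  simp [mL, eq_comm]

lemma mem_A (a b u v w : F) : (a, b, u, v, w) ∈ range (mA (F := F)) ↔ a = 0 := by
  simp [mA, eq_comm]

lemma mem_B (a b u v w : F) : (a, b, u, v, w) ∈ range (mB (F := F)) ↔ b = 0 := by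
  simp [mB, eq_comm]

lemma mem_U (a b u v w : F) : (a, b, u, v, w) ∈ range (mU (F := F)) ↔ u = 0 := by
  simp [mU, eq_comm]

lemma mem_W (a b u v w : F) : (a, b, u, v, w) ∈ range (mW (F := F)) ↔ w = 0 := by
  simp [mW, eq_comm]

lemma mem_S (s a b u v w : F) : (a, b, u, v, w) ∈ range (mS s) ↔ u = s * a ∧ v = 0 ∧ w = s * b := by
  simp [mS, eq_comm]

lemma mem_Y (y a b u v w : F) : (a, b, u, v, w) ∈ range (mY y) ↔ b = a ∧ u = 0 ∧ v = a ∧ w = y * a := by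
  simp [mY, eq_comm]

lemma fr_G (t : F) : Module.finrank F (range (mG t)) = 2 + 1 := by
  rw [LinearMap.finrank_range_of_inj]
  · simp
  · rintro ⟨_, _, _⟩ ⟨_, _, _⟩ h; simp [mG] at h ⊢; tauto

lemma fr_L : Module.finrank F (range (mL (F := F))) = 2 + 1 := by
  rw [LinearMap.finrank_range_of_inj]
  · simp
  · rintro ⟨_, _, _⟩ ⟨_, _, _⟩ h; simp [mL] at h ⊢; tauto

lemma fr_A : Module.finrank F (range (mA (F := F))) = 3 + 1 := by
  rw [LinearMap.finrank_range_of_inj]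
  · simp
  · rintro ⟨_, _, _, _⟩ ⟨_, _, _, _⟩ h; simp [mA] at h ⊢; tauto

lemma fr_B : Module.finrank F (range (mB (F := F))) = 3 + 1 := by
  rw [LinearMap.finrank_range_of_inj]
  · simp
  · rintro ⟨_, _, _, _⟩ ⟨_, _, _, _⟩ h; simp [mB] at h ⊢; tauto

lemma fr_U : Module.finrank F (range (mU (F := F))) = 3 + 1 := by
  rw [LinearMap.finrank_range_of_inj]
  · simp
  · rintro ⟨_, _, _, _⟩ ⟨_, _, _, _⟩ h; simp [mU] at h ⊢; tauto

lemma fr_W : Module.finrank F (range (mW (F := F))) = 3 + 1 := by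
  rw [LinearMap.finrank_range_of_inj]
  · simp
  · rintro ⟨_, _, _, _⟩ ⟨_, _, _, _⟩ h; simp [mW] at h ⊢; tauto

lemma fr_S (s : F) : Module.finrank F (range (mS s)) = 1 + 1 := by
  rw [LinearMap.finrank_range_of_inj]
  · simp
  · rintro ⟨_, _⟩ ⟨_, _⟩ h; simp [mS] at h ⊢; tauto

lemma fr_Y (y : F) : Module.finrank F (range (mY y)) = 0 + 1 := by
  rw [LinearMap.finrank_range_of_inj]
  · simp
  · intro _ _ h; simp [mY] at h; tauto

lemma fr_T : Module.finrank F (⊤ : Submodule F (V5 F)) = 4 + 1 := by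
  simp

/-- the minihyper (minus three) -/
noncomputable def Kz [Fintype F] [DecidableEq F] (S Y : Finset F) (x : V5 F) : ℤ :=
  3 * chi (⊤ : Submodule F (V5 F)) x - ∑ t ∈ Finset.univ.erase (0 : F), chi (range (mG t)) x + chi (range mL) x
    - (chi (range mA) x + chi (range mB) x + chi (range mU) x + chi (range mW) x)
    - ∑ s ∈ S, chi (range (mS s)) x - ∑ y ∈ Y, chi (range (mY y)) x

lemma Kz_smul [Fintype F] [DecidableEq F] (S Y : Finset F) (c : F) (x : V5 F) (hc : c ≠ 0) :
    Kz S Y (c • x) = Kz S Y x := by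
  simp only [Kz, chi_smul _ c x hc]

lemma Kz_sum [Fintype F] [DecidableEq F] (S Y : Finset F) :
    ∑ x ∈ Finset.univ.filter (fun x : V5 F => x ≠ 0), Kz S Y x =
    let q : ℤ := Fintype.card F
    3 * (q ^ 5 - 1) - (q - 1) * (q ^ 3 - 1) + (q ^ 3 - 1) - 4 * (q ^ 4 - 1)
     - S.card * (q ^ 2 - 1) - Y.card * (q - 1) := by
  have hq : 1 ≤ Fintype.card F := Fintype.card_pos
  simp only [Kz, Finset.sum_sub_distrib, Finset.sum_add_distrib, ← Finset.mul_sum]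
  rw [Finset.sum_comm, Finset.sum_comm (t := S), Finset.sum_comm (t := Y)]
  simp only [sum_chi_nonzero, fr_G, fr_L, fr_A, fr_B, fr_U, fr_W, fr_S, fr_Y, fr_T, Finset.sum_const,
    Finset.card_erase_of_mem (Finset.mem_univ (0 : F)), Finset.card_univ, nsmul_eq_mul,
    Nat.cast_sub hq]
  push_cast
  ring

lemma Kz_sum_phi [Fintype F] [DecidableEq F] (S Y : Finset F) (φ : V5 F →ₗ[F] F) :
    ∑ x ∈ Finset.univ.filter (fun x : V5 F => φ x ≠ 0), Kz S Y x =
    let q : ℤ := Fintype.card F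
    (q - 1) * (3 * q ^ 4 * Iw φ ⊤ - q ^ 2 * ∑ t ∈ Finset.univ.erase (0 : F), Iw φ (range (mG t))
      + q ^ 2 * Iw φ (range mL)
      - q ^ 3 * (Iw φ (range mA) + Iw φ (range mB) + Iw φ (range mU) + Iw φ (range mW))
      - q * ∑ s ∈ S, Iw φ (range (mS s)) - ∑ y ∈ Y, Iw φ (range (mY y))) := by
  simp only [Kz, Finset.sum_sub_distrib, Finset.sum_add_distrib, ← Finset.mul_sum]
  rw [Finset.sum_comm, Finset.sum_comm (t := S), Finset.sum_comm (t := Y)]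
  simp only [sum_chi_phi _ φ _ (fr_G _), sum_chi_phi _ φ _ (fr_S _), sum_chi_phi _ φ _ (fr_Y _),
    sum_chi_phi _ φ _ fr_L, sum_chi_phi _ φ _ fr_A, sum_chi_phi _ φ _ fr_B, sum_chi_phi _ φ _ fr_U,
    sum_chi_phi _ φ _ fr_W, sum_chi_phi _ φ _ fr_T, ← Finset.mul_sum]
  ring

lemma Iw_le (φ : V5 F →ₗ[F] F) (W : Submodule F (V5 F)) : Iw φ W ≤ 1 := by
  unfold Iw; split_ifs <;> simp

lemma Iw_zero (φ : V5 F →ₗ[F] F) (W : Submodule F (V5 F)) (h : W ≤ LinearMap.ker φ) : Iw φ W = 0 := by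
  simp [Iw, h]

lemma phi_bound [Fintype F] [DecidableEq F] (S Y : Finset F) (φ : V5 F →ₗ[F] F) (hφ : φ ≠ 0)
    (hq : 5 ≤ Fintype.card F) :
    let q : ℤ := Fintype.card F
    (q - 1) * (3 * q ^ 4 - 5 * q ^ 3 + 2 * q ^ 2 - q * S.card - Y.card) ≤
    ∑ x ∈ Finset.univ.filter (fun x : V5 F => φ x ≠ 0), Kz S Y x := by
  rw [Kz_sum_phi]
  have hq' : (5 : ℤ) ≤ Fintype.card F := by exact_mod_cast hq
  have hcq : ((Finset.univ.erase (0 : F)).card : ℤ) = Fintype.card F - 1 := by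
    rw [Finset.card_erase_of_mem (Finset.mem_univ (0 : F)), Finset.card_univ, Nat.cast_sub (by omega)]
    simp
  intro q
  have hq2 : (5 : ℤ) ≤ q := hq'
  apply mul_le_mul_of_nonneg_left _ (by omega)
  have hT : Iw φ ⊤ = 1 := by
    unfold Iw
    rw [if_neg]
    intro h
    apply hφ
    ext1 <;> (try ext) <;> exact h trivial
  have hS : ∑ s ∈ S, Iw φ (range (mS s)) ≤ S.card := by
    simpa using Finset.sum_le_card_nsmul S _ 1 (fun s _ => Iw_le φ (range (mS s)))
  have hY : ∑ s ∈ Y, Iw φ (range (mY s)) ≤ Y.card := by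
    simpa using Finset.sum_le_card_nsmul Y _ 1 (fun s _ => Iw_le φ (range (mY s)))
  have hG : ∑ t ∈ Finset.univ.erase (0 : F), Iw φ (range (mG t)) ≤ q - 1 := by
    have := Finset.sum_le_card_nsmul (Finset.univ.erase (0 : F)) _ 1 (fun s _ => Iw_le φ (range (mG s)))
    rw [nsmul_eq_mul, hcq, mul_one] at this
    exact this
  have hA := Iw_le φ (range mA)
  have hB := Iw_le φ (range mB)
  have hU := Iw_le φ (range mU)
  have hW := Iw_le φ (range mW)
  rw [hT]
  generalize hsS : ∑ s ∈ S, Iw φ (range (mS s)) = sS at *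
  generalize hsY : ∑ s ∈ Y, Iw φ (range (mY s)) = sY at *
  have key : (4 * q + (q - 2)) ≥ ∑ t ∈ Finset.univ.erase (0 : F), Iw φ (range (mG t)) - Iw φ (range mL)
      + q * (Iw φ (range mA) + Iw φ (range mB) + Iw φ (range mU) + Iw φ (range mW)) := by
    by_cases hL : range mL ≤ LinearMap.ker φ
    · rw [Iw_zero φ _ hL]
      have hf : ∀ a b u v w : F, φ (a, b, u, v, w) = a * φ (1, 0, 0, 0, 0) + b * φ (0, 1, 0, 0, 0) := by
        intro a b u v w
        have h1 : φ (0, 0, u, v, w) = 0 := hL ((mem_L _ _ _ _ _).2 ⟨rfl, rfl⟩)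
        have h2 : ((a, b, u, v, w) : V5 F) = a • ((1, 0, 0, 0, 0) : V5 F) + b • ((0, 1, 0, 0, 0) : V5 F) + (0, 0, u, v, w) := by
          simp
        rw [h2, map_add, map_add, map_smul, map_smul, h1]
        simp
      generalize φ (1, 0, 0, 0, 0) = α at hf
      generalize φ (0, 1, 0, 0, 0) = β at hf
      by_cases hα : α = 0
      · have : Iw φ (range mB) = 0 := by
          apply Iw_zero
          rintro ⟨a, b, u, v, w⟩ h
          rw [mem_B] at h
          rw [LinearMap.mem_ker, hf, hα, h]; ring
        nlinarith
      by_cases hβ : β = 0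
      · have : Iw φ (range mA) = 0 := by
          apply Iw_zero
          rintro ⟨a, b, u, v, w⟩ h
          rw [mem_A] at h
          rw [LinearMap.mem_ker, hf, hβ, h]; ring
        nlinarith
      have ht : β / α ∈ Finset.univ.erase (0 : F) := by simp [hα, hβ]
      have hG0 : Iw φ (range (mG (β / α))) = 0 := by
        apply Iw_zero
        rintro ⟨a, b, u, v, w⟩ h
        rw [mem_G] at h
        rw [LinearMap.mem_ker, hf]
        have := h.1
        field_simp at this
        linear_combination this
      have hG' : ∑ t ∈ Finset.univ.erase (0 : F), Iw φ (range (mG t)) ≤ q - 2 := by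
        rw [← Finset.add_sum_erase _ _ ht, hG0]
        have := Finset.sum_le_card_nsmul ((Finset.univ.erase (0 : F)).erase (β / α)) _ 1 (fun s _ => Iw_le φ (range (mG s)))
        rw [nsmul_eq_mul, mul_one, Finset.card_erase_of_mem ht, Nat.cast_sub (Finset.card_pos.2 ⟨_, ht⟩), hcq] at this
        push_cast at this
        linarith
      nlinarith
    · have : Iw φ (range mL) = 1 := by simp [Iw, hL]
      rw [this]
      nlinarith
  nlinarith [mul_le_mul_of_nonneg_left key (sq_nonneg q), mul_le_mul_of_nonneg_left hS (by linarith : 0 ≤ q)]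

lemma card_roots (u v w : F) [Fintype F] [DecidableEq F] (h : ¬ (u = 0 ∧ v = 0 ∧ w = 0)) :
    ((Finset.univ.erase (0 : F)).filter (fun t => u + t * v + t ^ 2 * w = 0)).card
      + (if u = 0 then 1 else 0) + (if w = 0 then 1 else 0) ≤ 2 := by
  by_cases hu : u = 0
  · by_cases hw : w = 0
    · have : (Finset.univ.erase (0 : F)).filter (fun t => u + t * v + t ^ 2 * w = 0) = ∅ := by
        ext t
        simp only [hu, hw]
        simp
        tauto
      simp [this]
      split_ifs <;> simp
    · have : (Finset.univ.erase (0 : F)).filter (fun t => u + t * v + t ^ 2 * w = 0) ⊆ {-v / w} := by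
        intro t
        simp only [Finset.mem_filter, Finset.mem_erase, Finset.mem_univ, and_true, Finset.mem_singleton, hu]
        rintro ⟨h1, h2⟩
        rw [eq_div_iff hw]
        apply mul_left_cancel₀ h1
        linear_combination h2
      have := Finset.card_le_card this
      simp only [Finset.card_singleton] at this
      simp only [hu, hw, if_true, if_false] at this ⊢
      omega
  · by_cases hw : w = 0
    · have : (Finset.univ.erase (0 : F)).filter (fun t => u + t * v + t ^ 2 * w = 0) ⊆ {-u / v} := by
        intro t
        simp only [Finset.mem_filter, Finset.mem_erase, Finset.mem_univ, and_true, Finset.mem_singleton, hw]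
        rintro ⟨h1, h2⟩
        have hv : v ≠ 0 := by
          rintro rfl
          apply hu
          linear_combination h2
        rw [eq_div_iff hv]
        linear_combination h2
      have := Finset.card_le_card this
      simp only [Finset.card_singleton] at this
      simp only [hu, hw, if_true, if_false] at this ⊢
      omega
    · simp only [hu, hw, if_false, add_zero]
      rcases Finset.eq_empty_or_nonempty ((Finset.univ.erase (0 : F)).filter (fun t => u + t * v + t ^ 2 * w = 0)) with h0 | ⟨t1, ht1⟩
      · simp [h0]
      · have : (Finset.univ.erase (0 : F)).filter (fun t => u + t * v + t ^ 2 * w = 0) ⊆ {t1, -v / w - t1} := by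
          intro t
          simp only [Finset.mem_filter, Finset.mem_erase, Finset.mem_univ, and_true, Finset.mem_singleton, Finset.mem_insert] at ht1 ⊢
          rintro ⟨h1, h2⟩
          by_cases htt : t = t1
          · exact Or.inl htt
          · right
            have h3 := ht1.2
            field_simp
            apply mul_left_cancel₀ (sub_ne_zero.2 htt)
            linear_combination h2 - h3
        exact (Finset.card_le_card this).trans Finset.card_le_two

lemma Kz_nonneg [Fintype F] [DecidableEq F] (S Y : Finset F) (hS : (0 : F) ∉ S) (x : V5 F) (hx : x ≠ 0) :
    0 ≤ Kz S Y x := by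
  obtain ⟨a, b, u, v, w⟩ := x
  simp only [Kz, chi, mem_G, mem_L, mem_A, mem_B, mem_U, mem_W, mem_S, mem_Y, Submodule.mem_top, if_true,
    Finset.sum_boole]
  have hS1 : ¬ (a = 0 ∧ b = 0) → (S.filter (fun s => u = s * a ∧ v = 0 ∧ w = s * b)).card ≤ 1 := by
    intro hab
    rw [Finset.card_le_one]
    intro s hs s' hs'
    simp only [Finset.mem_filter] at hs hs'
    by_cases ha : a = 0
    · have hb : b ≠ 0 := fun hb => hab ⟨ha, hb⟩
      exact mul_right_cancel₀ hb (hs.2.2.2.symm.trans hs'.2.2.2)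
    · exact mul_right_cancel₀ ha (hs.2.1.symm.trans hs'.2.1)
  have hY1 : ¬ (a = 0) → (Y.filter (fun y => b = a ∧ u = 0 ∧ v = a ∧ w = y * a)).card ≤ 1 := by
    intro ha
    rw [Finset.card_le_one]
    intro s hs s' hs'
    simp only [Finset.mem_filter] at hs hs'
    exact mul_right_cancel₀ ha (hs.2.2.2.2.symm.trans hs'.2.2.2.2)
  have hS0 : (S.filter (fun s => u = s * a ∧ v = 0 ∧ w = s * b)).card ≠ 0 →
      ∃ s, s ≠ 0 ∧ u = s * a ∧ v = 0 ∧ w = s * b := by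
    intro h
    obtain ⟨s, hs⟩ := Finset.card_ne_zero.1 h
    simp only [Finset.mem_filter] at hs
    exact ⟨s, fun h => hS (h ▸ hs.1), hs.2⟩
  have hY0 : (Y.filter (fun y => b = a ∧ u = 0 ∧ v = a ∧ w = y * a)).card ≠ 0 →
      b = a ∧ u = 0 ∧ v = a ∧ ∃ y, w = y * a := by
    intro h
    obtain ⟨s, hs⟩ := Finset.card_ne_zero.1 h
    simp only [Finset.mem_filter] at hs
    exact ⟨hs.2.1, hs.2.2.1, hs.2.2.2.1, s, hs.2.2.2.2⟩
  have hN0 : ((Finset.univ.erase (0 : F)).filter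
      (fun t => a + t * b = 0 ∧ u + t * v + t ^ 2 * w = 0)).card ≠ 0 →
      ∃ t, t ≠ 0 ∧ a + t * b = 0 ∧ u + t * v + t ^ 2 * w = 0 := by
    intro h
    obtain ⟨s, hs⟩ := Finset.card_ne_zero.1 h
    simp only [Finset.mem_filter, Finset.mem_erase] at hs
    exact ⟨s, hs.1.1, hs.2⟩
  have hN1 : b ≠ 0 → ((Finset.univ.erase (0 : F)).filter
      (fun t => a + t * b = 0 ∧ u + t * v + t ^ 2 * w = 0)).card ≤ 1 := by
    intro hb
    rw [Finset.card_le_one]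
    intro s hs s' hs'
    simp only [Finset.mem_filter] at hs hs'
    apply mul_right_cancel₀ hb
    linear_combination hs.2.1 - hs'.2.1
  have hR : a = 0 → b = 0 → ((Finset.univ.erase (0 : F)).filter
      (fun t => a + t * b = 0 ∧ u + t * v + t ^ 2 * w = 0)).card
      + (if u = 0 then 1 else 0) + (if w = 0 then 1 else 0) ≤ 2 := by
    rintro rfl rfl
    have := card_roots u v w (by rintro ⟨rfl, rfl, rfl⟩; exact hx rfl)
    simpa using this
  generalize (S.filter (fun s => u = s * a ∧ v = 0 ∧ w = s * b)).card = NS at *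
  generalize (Y.filter (fun y => b = a ∧ u = 0 ∧ v = a ∧ w = y * a)).card = NY at *
  generalize ((Finset.univ.erase (0 : F)).filter
      (fun t => a + t * b = 0 ∧ u + t * v + t ^ 2 * w = 0)).card = N at *
  have hx' : ¬ (a = 0 ∧ b = 0 ∧ u = 0 ∧ v = 0 ∧ w = 0) := by
    rintro ⟨rfl, rfl, rfl, rfl, rfl⟩; exact hx rfl
  by_cases ha : a = 0
  · have hY2 : NY = 0 := by
      by_contra h
      obtain ⟨h1, h2, h3, y, h4⟩ := hY0 h
      apply hx'
      simp_all
    by_cases hb : b = 0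
    · have hS2 : NS = 0 := by
        by_contra h
        obtain ⟨s, h1, h2, h3, h4⟩ := hS0 h
        apply hx'
        simp_all
      have := hR ha hb
      simp only [ha, hb, hY2, hS2] at this ⊢
      split_ifs at this ⊢ <;> simp_all <;> omega
    · have hN2 : N = 0 := by
        by_contra h
        obtain ⟨t, h1, h2, h3⟩ := hN0 h
        simp_all
      have hS2 := hS1 (fun h => hb h.2)
      have hS3 : w = 0 → NS = 0 := by
        intro hw
        by_contra h
        obtain ⟨s, h1, h2, h3, h4⟩ := hS0 h
        simp_all
      simp only [ha, hb, hY2, hN2]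
      by_cases hu : u = 0 <;> by_cases hw : w = 0 <;> simp_all
  · have hS2 := hS1 (fun h => ha h.1)
    have hY2 := hY1 ha
    by_cases hb : b = 0
    · have hN2 : N = 0 := by
        by_contra h
        obtain ⟨t, h1, h2, h3⟩ := hN0 h
        simp_all
      have hY3 : NY = 0 := by
        by_contra h
        obtain ⟨h1, h2, h3, y, h4⟩ := hY0 h
        exact ha (h1.symm.trans hb)
      have hS3 : u = 0 → NS = 0 := by
        intro hw
        by_contra h
        obtain ⟨s, h1, h2, h3, h4⟩ := hS0 h
        simp_all
      simp only [ha, hb, hY3, hN2]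
      by_cases hu : u = 0 <;> by_cases hw : w = 0 <;> simp_all
    · have hN2 := hN1 hb
      by_cases hNS : NS = 0
      · by_cases hNY : NY = 0
        · simp only [ha, hb, hNS, hNY]
          by_cases hu : u = 0 <;> by_cases hw : w = 0 <;> simp [hu, hw] <;> omega
        · obtain ⟨h1, h2, h3, y, h4⟩ := hY0 hNY
          have hN3 : w = 0 → N = 0 := by
            intro hw
            by_contra h
            obtain ⟨t, h5, h6, h7⟩ := hN0 h
            rw [h2, h3, hw] at h7
            have : t * a = 0 := by linear_combination h7
            simp_all
          simp only [ha, hb, hNS]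
          by_cases hw : w = 0
          · have := hN3 hw
            simp [h2, hw]; omega
          · simp [h2, hw]; omega
      · obtain ⟨s, h1, h2, h3, h4⟩ := hS0 hNS
        have hu : u ≠ 0 := by rw [h2]; exact mul_ne_zero h1 ha
        have hw : w ≠ 0 := by rw [h4]; exact mul_ne_zero h1 hb
        simp [ha, hb, hu, hw]
        omega

end

lemma ceil_eq (d p m : ℕ) (hp : 0 < p) (h1 : (d : ℤ) ≤ p * m) (h2 : (p : ℤ) * m < d + p) :
    (d + p - 1) / p = m := by
  have h3 : d ≤ p * m := by exact_mod_cast h1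
  have h4 : p * m < d + p := by exact_mod_cast h2
  rw [Nat.div_eq_iff hp, mul_comm m p]
  omega

lemma griesmer_eq (q d t r : ℕ) (hq5 : 5 ≤ q) (hr : r < q) (ht : t * q + r ≤ q * (q - 1))
    (hd : (d : ℤ) = 3 * (q : ℤ) ^ 4 - 5 * (q : ℤ) ^ 3 + 2 * (q : ℤ) ^ 2 - (t * q + r)) :
    (griesmer q 5 d : ℤ) = 3 * (q : ℤ) ^ 4 - 2 * (q : ℤ) ^ 3 + 1 - t * q - t - r := by
  have hq : (5 : ℤ) ≤ q := by exact_mod_cast hq5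
  have hr' : (r : ℤ) < q := by exact_mod_cast hr
  have hr0 : (0 : ℤ) ≤ r := by positivity
  have ht0 : (0 : ℤ) ≤ t := by positivity
  have ht' : (t : ℤ) * q + r ≤ q * (q - 1) := by
    have : ((t * q + r : ℕ) : ℤ) ≤ ((q * (q - 1) : ℕ) : ℤ) := by exact_mod_cast ht
    push_cast [Nat.cast_sub (by omega : 1 ≤ q)] at this
    exact this
  have htq : (0 : ℤ) ≤ t * q := by positivity
  have htq1 : (t : ℤ) ≤ q := by nlinarith
  have e3 : (q : ℤ) ^ 3 = q * q ^ 2 := by ring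
  have e4 : (q : ℤ) ^ 4 = q * q ^ 3 := by ring
  have b2 : 5 * (q : ℤ) ≤ q ^ 2 := by nlinarith
  have b3 : 5 * (q : ℤ) ^ 2 ≤ q ^ 3 := by rw [e3]; nlinarith
  have b4 : 5 * (q : ℤ) ^ 3 ≤ q ^ 4 := by rw [e4]; nlinarith
  have c0 : (d + q ^ 0 - 1) / q ^ 0 = d := by simp
  obtain ⟨m1, hm1⟩ := Int.eq_ofNat_of_zero_le
    (show (0 : ℤ) ≤ 3 * (q : ℤ) ^ 3 - 5 * (q : ℤ) ^ 2 + 2 * q - t by nlinarith)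
  obtain ⟨m2, hm2⟩ := Int.eq_ofNat_of_zero_le
    (show (0 : ℤ) ≤ 3 * (q : ℤ) ^ 2 - 5 * (q : ℤ) + 2 by nlinarith)
  obtain ⟨m3, hm3⟩ := Int.eq_ofNat_of_zero_le
    (show (0 : ℤ) ≤ 3 * (q : ℤ) - 4 by nlinarith)
  have q2 : (q : ℤ) * (q - 1) = q ^ 2 - q := by ring
  rw [q2] at ht'
  have c1 : (d + q ^ 1 - 1) / q ^ 1 = m1 := by
    have h : (q : ℤ) ^ 1 * (3 * (q : ℤ) ^ 3 - 5 * (q : ℤ) ^ 2 + 2 * q - t)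
      = 3 * (q : ℤ) ^ 4 - 5 * (q : ℤ) ^ 3 + 2 * (q : ℤ) ^ 2 - t * q := by ring
    rw [hm1] at h
    apply ceil_eq _ _ _ (by positivity) <;> push_cast <;> rw [h, hd] <;> linarith
  have c2 : (d + q ^ 2 - 1) / q ^ 2 = m2 := by
    have h : (q : ℤ) ^ 2 * (3 * (q : ℤ) ^ 2 - 5 * (q : ℤ) + 2)
      = 3 * (q : ℤ) ^ 4 - 5 * (q : ℤ) ^ 3 + 2 * (q : ℤ) ^ 2 := by ring
    rw [hm2] at h
    apply ceil_eq _ _ _ (by positivity) <;> push_cast <;> rw [h, hd] <;> linarith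
  have c3 : (d + q ^ 3 - 1) / q ^ 3 = m3 := by
    have h : (q : ℤ) ^ 3 * (3 * (q : ℤ) - 4)
      = 3 * (q : ℤ) ^ 4 - 4 * (q : ℤ) ^ 3 := by ring
    rw [hm3] at h
    apply ceil_eq _ _ _ (by positivity) <;> push_cast <;> rw [h, hd] <;> linarith
  have c4 : (d + q ^ 4 - 1) / q ^ 4 = 3 := by
    apply ceil_eq _ _ _ (by positivity) <;> push_cast <;> rw [hd] <;> linarith
  simp only [griesmer, Finset.sum_range_succ, Finset.sum_range_zero, c0, c1, c2, c3, c4]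
  push_cast
  rw [← hm1, ← hm2, ← hm3, hd]
  ring

/-- For every prime power `q ≥ 5` and every `d` with
`3q⁴ - 5q³ + q² + q ≤ d ≤ 3q⁴ - 5q³ + 2q²` there exists a `[g_q(5,d), 5, d]_q` code. -/
theorem statement3 (q d : ℕ) (hq : IsPrimePow q) (hq5 : 5 ≤ q)
    (hd1 : 3 * (q : ℤ) ^ 4 - 5 * (q : ℤ) ^ 3 + (q : ℤ) ^ 2 + (q : ℤ) ≤ (d : ℤ))
    (hd2 : (d : ℤ) ≤ 3 * (q : ℤ) ^ 4 - 5 * (q : ℤ) ^ 3 + 2 * (q : ℤ) ^ 2)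
    (F : Type) [Field F] [Fintype F] [DecidableEq F] (hF : Fintype.card F = q) :
    ∃ C : Submodule F (Fin (griesmer q 5 d) → F),
      IsLinearCodeWith F (griesmer q 5 d) 5 d C := by
  have hqz : (5 : ℤ) ≤ q := by exact_mod_cast hq5
  obtain ⟨e, he⟩ := Int.eq_ofNat_of_zero_le
    (show (0 : ℤ) ≤ 3 * (q : ℤ) ^ 4 - 5 * (q : ℤ) ^ 3 + 2 * (q : ℤ) ^ 2 - d by linarith)
  have hdm : e / q * q + e % q = e := Nat.div_add_mod' e q
  have hr : e % q < q := Nat.mod_lt _ (by omega)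
  have hee : e ≤ q * (q - 1) := by
    zify [(by omega : 1 ≤ q)]
    nlinarith
  have ht : e / q ≤ q - 1 := by
    apply Nat.div_le_of_le_mul hee
  generalize e / q = t at *
  generalize e % q = r at *
  have hd : (d : ℤ) = 3 * (q : ℤ) ^ 4 - 5 * (q : ℤ) ^ 3 + 2 * (q : ℤ) ^ 2 - (t * q + r) := by
    have : ((t : ℤ) * q + r) = e := by exact_mod_cast hdm
    rw [this]
    have he' : 3 * (q : ℤ) ^ 4 - 5 * (q : ℤ) ^ 3 + 2 * (q : ℤ) ^ 2 - d = (e : ℤ) := he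
    linarith
  have hn := griesmer_eq q d t r hq5 hr (by omega) hd
  obtain ⟨S, hS, hSc⟩ := Finset.exists_subset_card_eq (s := Finset.univ.erase (0 : F)) (n := t) (by
    rw [Finset.card_erase_of_mem (Finset.mem_univ _), Finset.card_univ, hF]; exact ht)
  obtain ⟨Y, -, hYc⟩ := Finset.exists_subset_card_eq (s := (Finset.univ : Finset F)) (n := r) (by
    rw [Finset.card_univ, hF]; exact hr.le)
  have hS0 : (0 : F) ∉ S := fun h => by simpa using hS h
  have hd0 : 1 ≤ d := by
    have : (1 : ℤ) ≤ d := by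
      have e4 : (q : ℤ) ^ 4 = q * q ^ 3 := by ring
      have : 0 ≤ (q : ℤ) ^ 3 := by positivity
      nlinarith
    exact_mod_cast this
  have hcast : ((Fintype.card F - 1 : ℕ) : ℤ) = q - 1 := by
    rw [hF, Nat.cast_sub (by omega)]; simp
  refine code_of_weights (V := V5 F) _ 5 d hd0 (by norm_num) (by simp) (fun x => (Kz S Y x).toNat) ?_ ?_ ?_
  · intro c v hc
    simp only [Kz_smul S Y c v hc]
  · have h1 := Kz_sum S Y
    zify
    rw [hcast, hn, Finset.sum_congr rfl (g := fun x => Kz S Y x), h1]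
    · simp only [hF, hSc, hYc]
      ring
    · intro x hx
      exact Int.toNat_of_nonneg (Kz_nonneg S Y hS0 x (by simpa using hx))
  · intro φ hφ
    have h1 := phi_bound S Y φ hφ (by omega)
    zify
    rw [hcast, Finset.sum_congr rfl (g := fun x => Kz S Y x)]
    · refine le_trans (le_of_eq ?_) h1
      simp only [hF, hSc, hYc, hd]
      ring
    · intro x hx
      refine Int.toNat_of_nonneg (Kz_nonneg S Y hS0 x ?_)
      rintro rfl
      simp at hx
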